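/- There exist c > 0 and N such that for all n ≥ N: E_{ν_n⊗ν_n}[(CV_{AB} − CV_A·CV_B)²] ≥ c·n², where the expectation is over two independent random balanced dice A, B with faces in [−√3, √3], each distributed according to ν_n. -/

import Mathlib

open MeasureTheory ProbabilityTheory Set
open scoped ENNReal NNReal

noncomputable def extendDie (n : ℕ) (s : ℝ) (a : Fin (n - 1) → ℝ) : Fin n → ℝ :=
  fun i => if h : (i : ℕ) < n - 1 then a ⟨i, h⟩ else s - ∑ j, a j

noncomputable def diceMeasure (n : ℕ) (lo hi s : ℝ) : Measure (Fin n → ℝ) :=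
  Measure.map (extendDie n s)
    (ProbabilityTheory.cond volume
      {a : Fin (n - 1) → ℝ | (∀ i, a i ∈ Set.Icc lo hi) ∧ (s - ∑ i, a i) ∈ Set.Icc lo hi})

/-- `g_A(x) = |{i : a_i ≤ x}| - n·(x+√3)/(2√3)` for a die with faces in `[-√3,√3]`. -/
noncomputable def gDie (n : ℕ) (A : Fin n → ℝ) (x : ℝ) : ℝ :=
  ((Finset.univ.filter fun i => A i ≤ x).card : ℝ) -
    n * ((x + Real.sqrt 3) / (2 * Real.sqrt 3))

/-- Expectation with respect to `V` uniform on `[-√3,√3]`. -/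
noncomputable def meanS (f : ℝ → ℝ) : ℝ :=
  (2 * Real.sqrt 3)⁻¹ * ∫ x in Set.Icc (-Real.sqrt 3) (Real.sqrt 3), f x

/-- `CV_A = Cov(g_A(V), V)`. -/
noncomputable def cvDie (n : ℕ) (A : Fin n → ℝ) : ℝ :=
  meanS (fun x => gDie n A x * x) - meanS (gDie n A) * meanS (fun x => x)

/-- `CV_{AB} = Cov(g_A(V), g_B(V))`. -/
noncomputable def cvDie₂ (n : ℕ) (A B : Fin n → ℝ) : ℝ :=
  meanS (fun x => gDie n A x * gDie n B x) - meanS (gDie n A) * meanS (gDie n B)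


lemma sq3 : Real.sqrt 3 ^ 2 = 3 := Real.sq_sqrt (by norm_num)
lemma s3pos : 0 < Real.sqrt 3 := by positivity

noncomputable def tauS : Measure ℝ := volume.restrict (Set.Icc (-Real.sqrt 3) (Real.sqrt 3))

instance : IsFiniteMeasure tauS := by unfold tauS; infer_instance

lemma meanS_eq (f : ℝ → ℝ) : meanS f = (2 * Real.sqrt 3)⁻¹ * ∫ x, f x ∂tauS := rfl

noncomputable def phiS (x : ℝ) : ℝ := x ^ 3 - 9 / 5 * x

lemma cont_phiS : Continuous phiS := by unfold phiS; fun_prop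

lemma integrable_tau {f : ℝ → ℝ} (hf : Measurable f) (C : ℝ)
    (hC : ∀ x ∈ Set.Icc (-Real.sqrt 3) (Real.sqrt 3), |f x| ≤ C) : Integrable f tauS := by
  refine Integrable.of_bound hf.aestronglyMeasurable C ?_
  exact (ae_restrict_iff' measurableSet_Icc).2 (Filter.Eventually.of_forall fun x hx => hC x hx)

lemma cont_bdd {f : ℝ → ℝ} (hf : Continuous f) :
    ∃ C, 0 ≤ C ∧ ∀ x ∈ Set.Icc (-Real.sqrt 3) (Real.sqrt 3), |f x| ≤ C := by
  obtain ⟨C, hC⟩ := (isCompact_Icc (a := -Real.sqrt 3) (b := Real.sqrt 3)).exists_bound_of_continuousOn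
    hf.continuousOn
  exact ⟨max C 0, le_max_right _ _, fun x hx => (hC x hx).trans (le_max_left _ _)⟩

lemma integrable_cont {f : ℝ → ℝ} (hf : Continuous f) : Integrable f tauS := by
  obtain ⟨C, _, hC⟩ := cont_bdd hf
  exact integrable_tau hf.measurable C hC

lemma integrable_mul_cont {G f : ℝ → ℝ} (hG : Measurable G) (C : ℝ)
    (hC : ∀ x ∈ Set.Icc (-Real.sqrt 3) (Real.sqrt 3), |G x| ≤ C) (hf : Continuous f) :
    Integrable (fun x => G x * f x) tauS := by
  obtain ⟨K, _, hK⟩ := cont_bdd hf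
  refine integrable_tau (hG.mul hf.measurable) (C * K) fun x hx => ?_
  rw [abs_mul]
  exact mul_le_mul (hC x hx) (hK x hx) (abs_nonneg _) ((abs_nonneg _).trans (hC x hx))

lemma tau_interval (f : ℝ → ℝ) :
    ∫ x, f x ∂tauS = ∫ x in (-Real.sqrt 3)..(Real.sqrt 3), f x := by
  rw [intervalIntegral.integral_of_le (by linarith [s3pos]), ← integral_Icc_eq_integral_Ioc]; rfl

lemma meanS_pow (k : ℕ) : meanS (fun x => x ^ k) =
    (2 * Real.sqrt 3)⁻¹ * ((Real.sqrt 3 ^ (k+1) - (-Real.sqrt 3) ^ (k+1)) / (k+1)) := by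
  rw [meanS_eq, tau_interval, integral_pow]

lemma meanS_mul_left (c : ℝ) (f : ℝ → ℝ) : meanS (fun x => c * f x) = c * meanS f := by
  simp only [meanS_eq, integral_const_mul]; ring

lemma meanS_add {f g : ℝ → ℝ} (hf : Integrable f tauS) (hg : Integrable g tauS) :
    meanS (fun x => f x + g x) = meanS f + meanS g := by
  simp only [meanS_eq, integral_add hf hg]; ring

lemma meanS_sub {f g : ℝ → ℝ} (hf : Integrable f tauS) (hg : Integrable g tauS) :
    meanS (fun x => f x - g x) = meanS f - meanS g := by
  simp only [meanS_eq, integral_sub hf hg]; ring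

lemma meanS_quad (a b c : ℝ) :
    meanS (fun x => (a + b * x + c * phiS x) ^ 2) = a ^ 2 + b ^ 2 + c ^ 2 * (108 / 175) := by
  have h : (fun x => (a + b * x + c * phiS x) ^ 2) = fun x =>
      (a^2) * x^0 + (2*a*(b - 9/5*c)) * x^1 + ((b - 9/5*c)^2) * x^2 + (2*a*c)*x^3
       + (2*c*(b - 9/5*c))*x^4 + c^2 * x^6 := by
    funext x; unfold phiS; ring
  have I : ∀ (c : ℝ) (k : ℕ), Integrable (fun x : ℝ => c * x^k) tauS := fun c k =>
    integrable_cont (by fun_prop)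
  rw [h, meanS_add (by exact (((((I _ _).add (I _ _)).add (I _ _)).add (I _ _)).add (I _ _))) (I _ _),
    meanS_add (by exact ((((I _ _).add (I _ _)).add (I _ _)).add (I _ _))) (I _ _),
    meanS_add (by exact (((I _ _).add (I _ _)).add (I _ _))) (I _ _),
    meanS_add (by exact ((I _ _).add (I _ _))) (I _ _),
    meanS_add (I _ _) (I _ _)]
  simp only [meanS_mul_left, meanS_pow]
  have h3 := sq3
  have hp := s3pos
  have e2 : Real.sqrt 3 ^ (2+1) = 3 * Real.sqrt 3 := by rw [pow_succ, h3]
  have e4 : Real.sqrt 3 ^ (4+1) = 9 * Real.sqrt 3 := by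
    rw [show 4+1 = 2*2+1 by norm_num, pow_succ, pow_mul, h3]; norm_num
  have e6 : Real.sqrt 3 ^ (6+1) = 27 * Real.sqrt 3 := by
    rw [show 6+1 = 2*3+1 by norm_num, pow_succ, pow_mul, h3]; norm_num
  rw [Odd.neg_pow (by decide : Odd (2+1)), Odd.neg_pow (by decide : Odd (4+1)),
    Odd.neg_pow (by decide : Odd (6+1)), Even.neg_pow (by decide : Even (1+1)),
    Even.neg_pow (by decide : Even (3+1)), e2, e4, e6]
  push_cast
  field_simp
  ring

lemma bessel {G : ℝ → ℝ} (hG : Measurable G) (C : ℝ)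
    (hC : ∀ x ∈ Set.Icc (-Real.sqrt 3) (Real.sqrt 3), |G x| ≤ C) :
    175 / 108 * meanS (fun x => G x * phiS x) ^ 2 ≤
      meanS (fun x => G x * G x) - meanS G ^ 2 - meanS (fun x => G x * x) ^ 2 := by
  set a := meanS G with ha
  set b := meanS (fun x => G x * x) with hb
  set d := meanS (fun x => G x * phiS x) with hd
  have I1 : Integrable G tauS := integrable_tau hG C hC
  have I2 := integrable_mul_cont hG C hC continuous_id
  have I3 := integrable_mul_cont hG C hC cont_phiS
  have I4 : Integrable (fun x => G x * G x) tauS := by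
    refine integrable_tau (hG.mul hG) (C * C) fun x hx => ?_
    rw [abs_mul]
    exact mul_le_mul (hC x hx) (hC x hx) (abs_nonneg _) ((abs_nonneg _).trans (hC x hx))
  set c := 175 / 108 * d with hc
  have I5 : Integrable (fun x => (a + b * x + c * phiS x) ^ 2) tauS :=
    integrable_cont (by have := cont_phiS; fun_prop)
  have h0 : 0 ≤ meanS (fun x => (G x - (a + b * x + c * phiS x)) ^ 2) := by
    rw [meanS_eq]
    have : 0 ≤ ∫ x, (G x - (a + b * x + c * phiS x)) ^ 2 ∂tauS := integral_nonneg fun x => sq_nonneg _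
    have := s3pos
    positivity
  have h1 : (fun x => (G x - (a + b * x + c * phiS x)) ^ 2) = fun x =>
      (G x * G x + (a + b * x + c * phiS x) ^ 2) -
       ((2 * a) * G x + (2 * b) * (G x * x) + (2 * c) * (G x * phiS x)) := by
    funext x; ring
  have J1 := I1.const_mul (2*a)
  have J2 := I2.const_mul (2*b)
  have J3 := I3.const_mul (2*c)
  simp only [id] at J2
  rw [h1, meanS_sub (by exact I4.add I5) (by exact (J1.add J2).add J3), meanS_add I4 I5,
    meanS_add (by exact J1.add J2) J3, meanS_add J1 J2, meanS_mul_left, meanS_mul_left,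
    meanS_mul_left, meanS_quad, ← ha, ← hb, ← hd] at h0
  rw [hc] at h0
  nlinarith

lemma gDie_eq (n : ℕ) (A : Fin n → ℝ) (x : ℝ) : gDie n A x =
    (∑ i, Set.indicator (Set.Ici (A i)) (fun _ => (1:ℝ)) x) -
      n * ((x + Real.sqrt 3) / (2 * Real.sqrt 3)) := by
  unfold gDie
  congr 1
  rw [Finset.card_filter]
  push_cast
  refine Finset.sum_congr rfl fun i _ => ?_
  simp [Set.indicator_apply]

lemma meas_gDie (n : ℕ) : Measurable (fun p : (Fin n → ℝ) × ℝ => gDie n p.1 p.2) := by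
  have : (fun p : (Fin n → ℝ) × ℝ => gDie n p.1 p.2) = fun p =>
    (∑ i, Set.indicator {p : (Fin n → ℝ) × ℝ | p.1 i ≤ p.2} (fun _ => (1:ℝ)) p) -
      n * ((p.2 + Real.sqrt 3) / (2 * Real.sqrt 3)) := by
    funext p
    rw [gDie_eq]
    congr 1
  rw [this]
  refine Measurable.sub ?_ (by fun_prop)
  refine Finset.measurable_sum _ fun i _ => ?_
  refine measurable_const.indicator ?_
  exact measurableSet_le (by fun_prop) (by fun_prop)

lemma meas_gDie_comp {α : Type*} [MeasurableSpace α] {n : ℕ} {f : α → Fin n → ℝ} {g : α → ℝ}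
    (hf : Measurable f) (hg : Measurable g) : Measurable (fun a => gDie n (f a) (g a)) :=
  Measurable.comp (g := fun p : (Fin n → ℝ) × ℝ => gDie n p.1 p.2) (f := fun a => (f a, g a))
    (meas_gDie n) (hf.prodMk hg)

lemma gDie_bdd (n : ℕ) (A : Fin n → ℝ) (x : ℝ)
    (hx : x ∈ Set.Icc (-Real.sqrt 3) (Real.sqrt 3)) : |gDie n A x| ≤ n := by
  have h1 : ((Finset.univ.filter fun i => A i ≤ x).card : ℝ) ≤ n := by
    exact_mod_cast (Finset.card_le_univ _).trans (by simp)
  have h2 : (0:ℝ) ≤ ((Finset.univ.filter fun i => A i ≤ x).card : ℝ) := by positivity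
  have h3 : 0 ≤ (x + Real.sqrt 3) / (2 * Real.sqrt 3) :=
    div_nonneg (by linarith [hx.1]) (by positivity)
  have h4 : (x + Real.sqrt 3) / (2 * Real.sqrt 3) ≤ 1 := by
    rw [div_le_one (by have := s3pos; positivity)]; linarith [hx.2]
  have h5 : (0:ℝ) ≤ n := by positivity
  unfold gDie
  rw [abs_le]
  constructor <;> nlinarith

lemma ae_tau : ∀ᵐ x ∂tauS, x ∈ Set.Icc (-Real.sqrt 3) (Real.sqrt 3) :=
  ae_restrict_mem measurableSet_Icc

lemma abs_meanS_le {f : ℝ → ℝ} (C : ℝ)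
    (hC : ∀ x ∈ Set.Icc (-Real.sqrt 3) (Real.sqrt 3), |f x| ≤ C) : |meanS f| ≤ C := by
  have hs := s3pos
  have h : ‖∫ x, f x ∂tauS‖ ≤ C * tauS.real univ :=
    norm_integral_le_of_norm_le_const (ae_tau.mono hC)
  have h2 : tauS.real univ = 2 * Real.sqrt 3 := by
    simp [tauS, Measure.real]
    ring
  rw [meanS_eq, abs_mul, abs_of_pos (by positivity : 0 < (2 * Real.sqrt 3)⁻¹)]
  rw [h2, Real.norm_eq_abs] at h
  rw [inv_mul_le_iff₀ (by positivity)]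
  linarith

lemma meas_meanS {α : Type*} [MeasurableSpace α] {f : α → ℝ → ℝ}
    (hf : Measurable (fun p : α × ℝ => f p.1 p.2)) : Measurable (fun a => meanS (f a)) := by
  simp only [meanS_eq]
  refine Measurable.const_mul ?_ _
  exact (hf.stronglyMeasurable.integral_prod_right (ν := tauS)).measurable

set_option linter.unusedSectionVars false
set_option linter.unusedVariables false

section fub
variable {n : ℕ} (ν : Measure (Fin n → ℝ)) [IsProbabilityMeasure ν] {D : (Fin n → ℝ) → ℝ}

noncomputable def GS (ν : Measure (Fin n → ℝ)) (D : (Fin n → ℝ) → ℝ) (x : ℝ) : ℝ :=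
  ∫ A, D A * gDie n A x ∂ν

lemma meas_GS (hD : Measurable D) : Measurable (GS ν D) := by
  have : Measurable (fun p : ℝ × (Fin n → ℝ) => D p.2 * gDie n p.2 p.1) :=
    (hD.comp measurable_snd).mul (meas_gDie_comp measurable_snd measurable_fst)
  exact (this.stronglyMeasurable.integral_prod_right (ν := ν)).measurable

lemma meas_g_right (x : ℝ) : Measurable (fun A => gDie n A x) :=
  meas_gDie_comp measurable_id measurable_const

lemma int_Dg (hDi : Integrable D ν) (x : ℝ)
    (hx : x ∈ Set.Icc (-Real.sqrt 3) (Real.sqrt 3)) :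
    Integrable (fun A => D A * gDie n A x) ν := by
  refine hDi.mul_bdd (c := n) (meas_g_right x).aestronglyMeasurable ?_
  exact Filter.Eventually.of_forall fun A => gDie_bdd n A x hx

lemma GS_bdd (hDi : Integrable D ν) (x : ℝ)
    (hx : x ∈ Set.Icc (-Real.sqrt 3) (Real.sqrt 3)) : |GS ν D x| ≤ (∫ A, |D A| ∂ν) * n := by
  unfold GS
  refine (abs_integral_le_integral_abs).trans ?_
  rw [← integral_mul_const]
  refine integral_mono (int_Dg ν hDi x hx).abs (hDi.abs.mul_const _) fun A => ?_
  simp only [abs_mul]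
  exact mul_le_mul_of_nonneg_left (gDie_bdd n A x hx) (abs_nonneg _)

lemma fub1 (hD : Measurable D) (hDi : Integrable D ν) {w : ℝ → ℝ} (hw : Continuous w) :
    ∫ A, D A * meanS (fun x => gDie n A x * w x) ∂ν = meanS (fun x => GS ν D x * w x) := by
  obtain ⟨K, hK0, hK⟩ := cont_bdd hw
  have hI : Integrable (fun p : (Fin n → ℝ) × ℝ => D p.1 * (gDie n p.1 p.2 * w p.2))
      (ν.prod tauS) := by
    refine (hDi.comp_fst tauS).mul_bdd (c := n * K)
      ((meas_gDie n).mul (hw.measurable.comp measurable_snd)).aestronglyMeasurable ?_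
    have : ∀ᵐ p ∂(ν.prod tauS), p.2 ∈ Set.Icc (-Real.sqrt 3) (Real.sqrt 3) :=
      Measure.quasiMeasurePreserving_snd.ae ae_tau
    filter_upwards [this] with p hp
    rw [Real.norm_eq_abs, abs_mul]
    exact mul_le_mul (gDie_bdd n _ _ hp) (hK _ hp) (abs_nonneg _) (by positivity)
  have := integral_integral_swap (f := fun A x => D A * (gDie n A x * w x)) hI
  simp only [meanS_eq]
  have h2 : ∀ A, D A * ((2 * Real.sqrt 3)⁻¹ * ∫ x, gDie n A x * w x ∂tauS) =
    (2 * Real.sqrt 3)⁻¹ * ∫ x, D A * (gDie n A x * w x) ∂tauS := fun A => by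
      rw [integral_const_mul]; ring
  simp only [h2]
  rw [integral_const_mul, this]
  congr 1
  refine integral_congr_ae (Filter.Eventually.of_forall fun x => ?_)
  simp only [GS]
  rw [← integral_mul_const]
  simp only [mul_assoc]

lemma fub2 (hD : Measurable D) (hDi : Integrable D ν) :
    ∫ p, (D p.1 * D p.2) * meanS (fun x => gDie n p.1 x * gDie n p.2 x) ∂(ν.prod ν) =
      meanS (fun x => GS ν D x * GS ν D x) := by
  have hI : Integrable (fun q : ((Fin n → ℝ) × (Fin n → ℝ)) × ℝ =>
      (D q.1.1 * D q.1.2) * (gDie n q.1.1 q.2 * gDie n q.1.2 q.2)) ((ν.prod ν).prod tauS) := by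
    refine ((hDi.mul_prod hDi).comp_fst tauS).mul_bdd (c := n * n) ?_ ?_
    · refine Measurable.aestronglyMeasurable ?_
      exact (meas_gDie_comp (measurable_fst.comp measurable_fst) measurable_snd).mul
        (meas_gDie_comp (measurable_snd.comp measurable_fst) measurable_snd)
    have : ∀ᵐ p ∂((ν.prod ν).prod tauS), p.2 ∈ Set.Icc (-Real.sqrt 3) (Real.sqrt 3) :=
      Measure.quasiMeasurePreserving_snd.ae ae_tau
    filter_upwards [this] with p hp
    rw [Real.norm_eq_abs, abs_mul]
    exact mul_le_mul (gDie_bdd n _ _ hp) (gDie_bdd n _ _ hp) (abs_nonneg _) (by positivity)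
  have := integral_integral_swap (μ := ν.prod ν) (ν := tauS)
    (f := fun q x => (D q.1 * D q.2) * (gDie n q.1 x * gDie n q.2 x)) hI
  simp only [meanS_eq]
  have h2 : ∀ p : (Fin n → ℝ) × (Fin n → ℝ),
    (D p.1 * D p.2) * ((2 * Real.sqrt 3)⁻¹ * ∫ x, gDie n p.1 x * gDie n p.2 x ∂tauS) =
    (2 * Real.sqrt 3)⁻¹ * ∫ x, (D p.1 * D p.2) * (gDie n p.1 x * gDie n p.2 x) ∂tauS := fun A => by
      rw [integral_const_mul]; ring
  simp only [h2]
  rw [integral_const_mul, this]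
  congr 1
  refine integral_congr_ae (Filter.Eventually.of_forall fun x => ?_)
  simp only [GS]
  rw [← integral_prod_mul]
  refine integral_congr_ae (Filter.Eventually.of_forall fun p => ?_)
  simp only
  ring

noncomputable def FS (n : ℕ) (p : (Fin n → ℝ) × (Fin n → ℝ)) : ℝ :=
  cvDie₂ n p.1 p.2 - cvDie n p.1 * cvDie n p.2

lemma meanS_id : meanS (fun x => x) = 0 := by
  have := meanS_pow 1
  simp only [pow_one] at this
  rw [this]; norm_num

lemma FS_eq (p : (Fin n → ℝ) × (Fin n → ℝ)) : FS n p =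
    meanS (fun x => gDie n p.1 x * gDie n p.2 x) - meanS (gDie n p.1) * meanS (gDie n p.2)
      - meanS (fun x => gDie n p.1 x * x) * meanS (fun x => gDie n p.2 x * x) := by
  simp only [FS, cvDie, cvDie₂, meanS_id]; ring

lemma meas_m0 : Measurable (fun A => meanS (gDie n A)) := meas_meanS (meas_gDie n)
lemma meas_m1 : Measurable (fun A => meanS (fun x => gDie n A x * x)) :=
  meas_meanS (f := fun A x => gDie n A x * x) ((meas_gDie n).mul measurable_snd)
lemma meas_m2 : Measurable (fun p : (Fin n → ℝ) × (Fin n → ℝ) =>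
    meanS (fun x => gDie n p.1 x * gDie n p.2 x)) :=
  meas_meanS (f := fun (p : (Fin n → ℝ) × (Fin n → ℝ)) x => gDie n p.1 x * gDie n p.2 x)
    ((meas_gDie_comp (measurable_fst.comp measurable_fst) measurable_snd).mul
        (meas_gDie_comp (measurable_snd.comp measurable_fst) measurable_snd))

lemma bdd_m0 (A : Fin n → ℝ) : |meanS (gDie n A)| ≤ n := abs_meanS_le _ (gDie_bdd n A)
lemma bdd_m1 (A : Fin n → ℝ) : |meanS (fun x => gDie n A x * x)| ≤ n * Real.sqrt 3 := by
  refine abs_meanS_le _ fun x hx => ?_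
  rw [abs_mul]
  exact mul_le_mul (gDie_bdd n _ _ hx) (abs_le.2 hx) (abs_nonneg _) (by positivity)
lemma bdd_m2 (A B : Fin n → ℝ) : |meanS (fun x => gDie n A x * gDie n B x)| ≤ n * n := by
  refine abs_meanS_le _ fun x hx => ?_
  rw [abs_mul]
  exact mul_le_mul (gDie_bdd n _ _ hx) (gDie_bdd n _ _ hx) (abs_nonneg _) (by positivity)

lemma meas_FS : Measurable (FS n) := by
  have : FS n = fun p => _ := funext FS_eq
  rw [this]
  exact (meas_m2.sub ((meas_m0.comp measurable_fst).mul (meas_m0.comp measurable_snd))).sub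
    ((meas_m1.comp measurable_fst).mul (meas_m1.comp measurable_snd))

lemma bdd_FS (p : (Fin n → ℝ) × (Fin n → ℝ)) :
    |FS n p| ≤ n * n + n * n + (n * Real.sqrt 3) * (n * Real.sqrt 3) := by
  rw [FS_eq]
  refine (abs_sub _ _).trans (add_le_add ((abs_sub _ _).trans (add_le_add (bdd_m2 _ _) ?_)) ?_)
  · rw [abs_mul]; exact mul_le_mul (bdd_m0 _) (bdd_m0 _) (abs_nonneg _) (by positivity)
  · rw [abs_mul]; exact mul_le_mul (bdd_m1 _) (bdd_m1 _) (abs_nonneg _) (by positivity)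

lemma int_FDD (hD : Measurable D) (hDi : Integrable D ν) :
    175 / 108 * (∫ A, D A * meanS (fun x => gDie n A x * phiS x) ∂ν) ^ 2 ≤
      ∫ p, (D p.1 * D p.2) * FS n p ∂(ν.prod ν) := by
  have hb := bessel (meas_GS ν hD) _ (GS_bdd ν hDi)
  rw [← fub1 ν hD hDi cont_phiS, ← fub2 ν hD hDi, ← fub1 ν hD hDi continuous_id'] at hb
  have h0 := fub1 ν hD hDi (w := fun _ => 1) continuous_const
  simp only [mul_one] at h0
  have e0 : meanS (GS ν D) = ∫ A, D A * meanS (gDie n A) ∂ν := h0.symm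
  rw [e0] at hb
  refine hb.trans (le_of_eq ?_)
  have J2 : Integrable (fun p : (Fin n → ℝ) × (Fin n → ℝ) =>
      (D p.1 * D p.2) * meanS (fun x => gDie n p.1 x * gDie n p.2 x)) (ν.prod ν) :=
    (hDi.mul_prod hDi).mul_bdd (c := n * n) meas_m2.aestronglyMeasurable
      (Filter.Eventually.of_forall fun p => bdd_m2 _ _)
  have J0 : Integrable (fun A => D A * meanS (gDie n A)) ν :=
    hDi.mul_bdd (c := n) meas_m0.aestronglyMeasurable
      (Filter.Eventually.of_forall fun p => bdd_m0 _)
  have J1 : Integrable (fun A => D A * meanS (fun x => gDie n A x * x)) ν :=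
    hDi.mul_bdd (c := n * Real.sqrt 3) meas_m1.aestronglyMeasurable
      (Filter.Eventually.of_forall fun p => bdd_m1 _)
  rw [sq, sq, ← integral_prod_mul, ← integral_prod_mul, ← integral_sub J2 (J0.mul_prod J0),
    ← integral_sub (by exact J2.sub (J0.mul_prod J0)) (J1.mul_prod J1)]
  refine integral_congr_ae (Filter.Eventually.of_forall fun p => ?_)
  simp only [FS_eq]
  ring

lemma partI (hD : Measurable D) (hDi : Integrable D ν) (hD2 : Integrable (fun A => D A ^ 2) ν)
    (l : ℝ) (hl : 0 ≤ l) :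
    2 * l * (175 / 108 * (∫ A, D A * meanS (fun x => gDie n A x * phiS x) ∂ν) ^ 2)
      - l ^ 2 * (∫ A, D A ^ 2 ∂ν) ^ 2 ≤ ∫ p, FS n p ^ 2 ∂(ν.prod ν) := by
  have K1 : Integrable (fun p => FS n p ^ 2) (ν.prod ν) := by
    refine Integrable.of_bound (meas_FS.pow_const 2).aestronglyMeasurable
      ((n * n + n * n + (n * Real.sqrt 3) * (n * Real.sqrt 3)) ^ 2)
      (Filter.Eventually.of_forall fun p => ?_)
    rw [Real.norm_eq_abs, abs_pow]
    exact pow_le_pow_left₀ (abs_nonneg _) (bdd_FS p) 2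
  have K2 : Integrable (fun p : (Fin n → ℝ) × (Fin n → ℝ) =>
      (D p.1 * D p.2) * FS n p) (ν.prod ν) :=
    (hDi.mul_prod hDi).mul_bdd (c := n * n + n * n + (n * Real.sqrt 3) * (n * Real.sqrt 3))
      meas_FS.aestronglyMeasurable
      (Filter.Eventually.of_forall fun p => bdd_FS _)
  have K3 := hD2.mul_prod hD2
  have h0 : 0 ≤ ∫ p, (FS n p - l * (D p.1 * D p.2)) ^ 2 ∂(ν.prod ν) :=
    integral_nonneg fun p => sq_nonneg _
  have e : ∀ p : (Fin n → ℝ) × (Fin n → ℝ), (FS n p - l * (D p.1 * D p.2)) ^ 2 =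
    FS n p ^ 2 - (2 * l) * ((D p.1 * D p.2) * FS n p) + l ^ 2 * (D p.1 ^ 2 * D p.2 ^ 2) :=
    fun p => by ring
  simp only [e] at h0
  rw [integral_add (by exact K1.sub (K2.const_mul _)) (K3.const_mul _),
    integral_sub K1 (K2.const_mul _), integral_const_mul, integral_const_mul,
    integral_prod_mul (fun A => D A ^ 2) (fun A => D A ^ 2)] at h0
  have := mul_le_mul_of_nonneg_left (int_FDD ν hD hDi) (by positivity : 0 ≤ 2 * l)
  nlinarith

end fub

noncomputable def psiS (x : ℝ) : ℝ := x ^ 4 - 18 / 5 * x ^ 2 + 9 / 5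

lemma psi_deriv (x : ℝ) : HasDerivAt (fun x => psiS x / 4) (phiS x) x := by
  unfold psiS phiS
  have := ((((hasDerivAt_pow 4 x).sub ((hasDerivAt_pow 2 x).const_mul (18/5))).add_const (9/5)).div_const 4)
  refine (this.congr_deriv ?_)
  norm_num; ring

lemma psiS_end : psiS (Real.sqrt 3) = 0 := by
  unfold psiS
  rw [show Real.sqrt 3 ^ 4 = (Real.sqrt 3 ^ 2)^2 by ring, sq3]; norm_num

lemma int_phi_tail (a : ℝ) (ha : a ∈ Set.Icc (-Real.sqrt 3) (Real.sqrt 3)) :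
    ∫ x, Set.indicator (Set.Ici a) (fun _ => (1:ℝ)) x * phiS x ∂tauS = - (psiS a / 4) := by
  have h1 : (fun x => Set.indicator (Set.Ici a) (fun _ => (1:ℝ)) x * phiS x) =
      Set.indicator (Set.Ici a) phiS := by
    funext x; by_cases h : x ∈ Set.Ici a <;> simp [Set.indicator, h]
  rw [h1, integral_indicator measurableSet_Ici, tauS, Measure.restrict_restrict measurableSet_Ici]
  have h2 : Set.Ici a ∩ Set.Icc (-Real.sqrt 3) (Real.sqrt 3) = Set.Icc a (Real.sqrt 3) := by
    ext x; simp only [Set.mem_inter_iff, Set.mem_Ici, Set.mem_Icc]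
    exact ⟨fun h => ⟨h.1, h.2.2⟩, fun h => ⟨h.1, ha.1.trans h.1, h.2⟩⟩
  rw [h2, integral_Icc_eq_integral_Ioc, ← intervalIntegral.integral_of_le ha.2,
    intervalIntegral.integral_eq_sub_of_hasDerivAt (fun x _ => psi_deriv x)
      (cont_phiS.intervalIntegrable _ _), psiS_end]
  ring

lemma int_phi_lin : ∫ x, ((x + Real.sqrt 3) / (2 * Real.sqrt 3)) * phiS x ∂tauS = 0 := by
  have h3 := sq3
  have hp := s3pos
  have hd : ∀ x, HasDerivAt (fun x => (x ^ 5 / 5 - 3 / 5 * x ^ 3 + Real.sqrt 3 * (psiS x / 4)) / (2 * Real.sqrt 3))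
     (((x + Real.sqrt 3) / (2 * Real.sqrt 3)) * phiS x) x := by
    intro x
    have := ((((hasDerivAt_pow 5 x).div_const 5).sub ((hasDerivAt_pow 3 x).const_mul (3/5))).add
      ((psi_deriv x).const_mul (Real.sqrt 3))).div_const (2 * Real.sqrt 3)
    refine this.congr_deriv ?_
    unfold phiS
    norm_num; ring
  rw [tau_interval, intervalIntegral.integral_eq_sub_of_hasDerivAt (fun x _ => hd x)
      (by have := cont_phiS; exact Continuous.intervalIntegrable (by fun_prop) _ _)]
  have e : psiS (-Real.sqrt 3) = 0 := by rw [← psiS_end]; unfold psiS; ring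
  rw [psiS_end, e]
  have e5 : Real.sqrt 3 ^ 5 = 9 * Real.sqrt 3 := by
    rw [show (5:ℕ) = 2*2+1 by norm_num, pow_succ, pow_mul, h3]; norm_num
  have e3 : Real.sqrt 3 ^ 3 = 3 * Real.sqrt 3 := by rw [pow_succ, h3]
  rw [Odd.neg_pow (by decide : Odd 5), Odd.neg_pow (by decide : Odd 3), e5, e3]
  field_simp
  ring

lemma Q_eq {n : ℕ} (A : Fin n → ℝ) (hA : ∀ i, A i ∈ Set.Icc (-Real.sqrt 3) (Real.sqrt 3)) :
    meanS (fun x => gDie n A x * phiS x) = -(8 * Real.sqrt 3)⁻¹ * ∑ i, psiS (A i) := by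
  have h1 : (fun x => gDie n A x * phiS x) = fun x =>
      (∑ i, Set.indicator (Set.Ici (A i)) (fun _ => (1:ℝ)) x * phiS x) -
       n * (((x + Real.sqrt 3) / (2 * Real.sqrt 3)) * phiS x) := by
    funext x; rw [gDie_eq, sub_mul, Finset.sum_mul]; ring
  have I1 : ∀ i ∈ Finset.univ, Integrable (fun x =>
      Set.indicator (Set.Ici (A i)) (fun _ => (1:ℝ)) x * phiS x) tauS := by
    intro i _
    refine integrable_mul_cont (measurable_const.indicator measurableSet_Ici) 1 ?_ cont_phiS
    intro x _
    by_cases h : x ∈ Set.Ici (A i) <;> simp [Set.indicator, h]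
  rw [meanS_eq, h1, integral_sub (integrable_finsetSum _ I1)
    (integrable_cont (by have := cont_phiS; fun_prop)), integral_finsetSum _ I1, integral_const_mul,
    int_phi_lin, Finset.sum_congr rfl fun i _ => int_phi_tail (A i) (hA i)]
  rw [Finset.sum_neg_distrib, ← Finset.sum_div]
  have := s3pos
  field_simp
  ring

section fibre
variable {m : ℕ}

lemma fibre0 {f : (Fin m → ℝ) → ℝ} (hf : Integrable f volume) (v : Fin m → ℝ) (p : Fin m) (hv : v p = 1)
    (h : ∀ a, ∫ u : ℝ, f (a + u • v) = 0) : ∫ a, f a = 0 := by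
  let ρ : ℝ → ℝ := Set.indicator (Set.Icc 0 1) (fun _ => (1:ℝ))
  have hρ : Integrable ρ volume :=
    (integrable_indicator_iff measurableSet_Icc).2 (by simp)
  have hρ1 : ∫ x, ρ x = 1 := by
    simp [ρ, integral_indicator measurableSet_Icc]
  -- shear maps
  have T1 : MeasurePreserving (fun z : ℝ × (Fin m → ℝ) => (z.1, z.2 + z.1 • v))
      (volume.prod volume) (volume.prod volume) := by
    refine (MeasurePreserving.id volume).skew_product (g := fun u a => a + u • v) ?_ ?_
    · fun_prop
    · exact Filter.Eventually.of_forall fun u => (measurePreserving_add_right volume (u • v)).map_eq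
  have T2 : MeasurePreserving (fun z : (Fin m → ℝ) × ℝ => (z.1, z.1 p - z.2))
      (volume.prod volume) (volume.prod volume) := by
    refine (MeasurePreserving.id volume).skew_product
      (g := fun (a : Fin m → ℝ) (u : ℝ) => a p - u) ?_ ?_
    · fun_prop
    · exact Filter.Eventually.of_forall fun a => (Measure.measurePreserving_sub_left volume _).map_eq
  have T := T2.comp ((Measure.measurePreserving_swap (μ := (volume : Measure ℝ))
    (ν := (volume : Measure (Fin m → ℝ)))).comp T1)
  have hh : Integrable (fun z : (Fin m → ℝ) × ℝ => f z.1 * ρ z.2) (volume.prod volume) :=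
    hf.mul_prod hρ
  have e1 : ∫ z : (Fin m → ℝ) × ℝ, f z.1 * ρ z.2 ∂(volume.prod volume) = ∫ a, f a := by
    rw [integral_prod_mul, hρ1, mul_one]
  have hh2 := hh
  rw [← T.map_eq] at e1 hh2
  rw [integral_map T.measurable.aemeasurable hh2.aestronglyMeasurable] at e1
  have hh3 := (integrable_map_measure hh2.aestronglyMeasurable T.measurable.aemeasurable).1 hh2
  rw [← e1]
  refine (integral_prod_symm _ hh3).trans ?_
  have : ∀ a : Fin m → ℝ, ∀ u : ℝ, (a + u • v) p - u = a p := by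
    intro a u; simp [hv]
  simp only [Function.comp, Prod.swap, this, integral_mul_const, h, zero_mul, integral_zero]

noncomputable def OmS (m : ℕ) : Set (Fin m → ℝ) :=
  {a | (∀ i, a i ∈ Set.Icc (-Real.sqrt 3) (Real.sqrt 3)) ∧
    (0 - ∑ i, a i) ∈ Set.Icc (-Real.sqrt 3) (Real.sqrt 3)}

lemma OmS_compact : IsCompact (OmS m) := by
  have : OmS m = (Set.univ.pi fun _ => Set.Icc (-Real.sqrt 3) (Real.sqrt 3)) ∩
      (fun a : Fin m → ℝ => 0 - ∑ i, a i) ⁻¹' Set.Icc (-Real.sqrt 3) (Real.sqrt 3) := by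
    ext a; simp only [OmS, Set.mem_inter_iff, Set.mem_univ_pi, Set.mem_preimage]; rfl
  rw [this]
  exact (isCompact_univ_pi fun _ => isCompact_Icc).inter_right
    (isClosed_Icc.preimage (by fun_prop))

lemma OmS_meas : MeasurableSet (OmS m) := OmS_compact.isClosed.measurableSet

lemma cont_int {f : (Fin m → ℝ) → ℝ} (hf : Continuous f) : IntegrableOn f (OmS m) volume :=
  hf.continuousOn.integrableOn_compact OmS_compact

noncomputable def vS (p q : Fin m) : Fin m → ℝ := Pi.single p 1 - Pi.single q 1

lemma vS_p {p q : Fin m} (h : p ≠ q) : vS p q p = 1 := by simp [vS, h]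
lemma vS_q {p q : Fin m} (h : p ≠ q) : vS p q q = -1 := by simp [vS, h.symm]
lemma vS_o {p q i : Fin m} (h : i ≠ p) (h' : i ≠ q) : vS p q i = 0 := by simp [vS, h, h']
lemma vS_sum (p q : Fin m) : ∑ i, vS p q i = 0 := by simp [vS]

lemma sum_shift (p q : Fin m) (a : Fin m → ℝ) (u : ℝ) :
    ∑ i, (a + u • vS p q) i = ∑ i, a i := by
  simp [Finset.sum_add_distrib, ← Finset.mul_sum, vS_sum]

lemma mem_shift {p q : Fin m} (h : p ≠ q) (a : Fin m → ℝ)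
    (ha : (∀ i, i ≠ p → i ≠ q → a i ∈ Set.Icc (-Real.sqrt 3) (Real.sqrt 3)) ∧
      (0 - ∑ i, a i) ∈ Set.Icc (-Real.sqrt 3) (Real.sqrt 3)) (u : ℝ) :
    a + u • vS p q ∈ OmS m ↔ (a p - a q) / 2 + u ∈ Set.Icc (-(Real.sqrt 3 - |(a p + a q) / 2|))
      (Real.sqrt 3 - |(a p + a q) / 2|) := by
  have hp : (a + u • vS p q) p = a p + u := by simp [vS_p h]
  have hq : (a + u • vS p q) q = a q - u := by simp [vS_q h]; ring
  have e1 : a + u • vS p q ∈ OmS m ↔ (a p + u ∈ Set.Icc (-Real.sqrt 3) (Real.sqrt 3) ∧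
      a q - u ∈ Set.Icc (-Real.sqrt 3) (Real.sqrt 3)) := by
    unfold OmS
    rw [Set.mem_ofPred_eq, sum_shift]
    constructor
    · intro hh
      have h1 := hh.1 p
      have h2 := hh.1 q
      rw [hp] at h1; rw [hq] at h2
      exact ⟨h1, h2⟩
    · intro hh
      refine ⟨fun i => ?_, ha.2⟩
      by_cases hip : i = p
      · subst hip; rw [hp]; exact hh.1
      by_cases hiq : i = q
      · subst hiq; rw [hq]; exact hh.2
      have : (a + u • vS p q) i = a i := by simp [vS_o hip hiq]
      rw [this]; exact ha.1 i hip hiq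
  rw [e1]
  simp only [Set.mem_Icc]
  constructor
  · rintro ⟨⟨h1, h2⟩, h3, h4⟩
    rcases abs_cases ((a p + a q) / 2) with ⟨e, _⟩ | ⟨e, _⟩ <;> rw [e] <;> constructor <;> linarith
  · rintro ⟨h1, h2⟩
    rcases abs_cases ((a p + a q) / 2) with ⟨e, _⟩ | ⟨e, _⟩ <;> rw [e] at h1 h2 <;>
      refine ⟨⟨?_, ?_⟩, ?_, ?_⟩ <;> linarith

lemma fibre1 {p q : Fin m} (h : p ≠ q) (H : ℝ → ℝ → ℝ) (Φ : (Fin m → ℝ) → ℝ)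
    (hΦ : ∀ (a : Fin m → ℝ) (u : ℝ), Φ (a + u • vS p q) = Φ a)
    (hc : Continuous (fun a : Fin m → ℝ => H ((a p + a q) / 2) ((a p - a q) / 2) * Φ a))
    (hH : ∀ s, 0 ≤ Real.sqrt 3 - |s| →
      ∫ t in (-(Real.sqrt 3 - |s|))..(Real.sqrt 3 - |s|), H s t = 0) :
    ∫ a in OmS m, H ((a p + a q) / 2) ((a p - a q) / 2) * Φ a = 0 := by
  rw [← integral_indicator OmS_meas]
  refine fibre0 ((integrable_indicator_iff OmS_meas).2 (cont_int hc)) (vS p q) p (vS_p h) ?_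
  intro a
  by_cases ha : (∀ i, i ≠ p → i ≠ q → a i ∈ Set.Icc (-Real.sqrt 3) (Real.sqrt 3)) ∧
      (0 - ∑ i, a i) ∈ Set.Icc (-Real.sqrt 3) (Real.sqrt 3)
  · set s := (a p + a q) / 2 with hs
    set w := Real.sqrt 3 - |s| with hw
    have key : ∀ u : ℝ, (OmS m).indicator
        (fun a => H ((a p + a q) / 2) ((a p - a q) / 2) * Φ a) (a + u • vS p q) =
        (Set.Icc (-w) w).indicator (H s) ((a p - a q) / 2 + u) * Φ a := by
      intro u
      have hp : (a + u • vS p q) p = a p + u := by simp [vS_p h]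
      have hq : (a + u • vS p q) q = a q - u := by simp [vS_q h]; ring
      have hm := mem_shift h a ha u
      by_cases hu : a + u • vS p q ∈ OmS m
      · rw [Set.indicator_of_mem hu, Set.indicator_of_mem (hm.1 hu), hΦ, hp, hq]
        congr 2
        · rw [hs]; ring
        · ring
      · rw [Set.indicator_of_notMem hu, Set.indicator_of_notMem (fun h => hu (hm.2 h)), zero_mul]
    simp only [key]
    rw [integral_mul_const, integral_add_left_eq_self (fun t => (Set.Icc (-w) w).indicator (H s) t),
      integral_indicator measurableSet_Icc]
    by_cases hw0 : 0 ≤ w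
    · rw [integral_Icc_eq_integral_Ioc, ← intervalIntegral.integral_of_le (by linarith), hH s hw0,
        zero_mul]
    · rw [Set.Icc_eq_empty (by linarith)]; simp
  · have key : ∀ u : ℝ, (OmS m).indicator
        (fun a => H ((a p + a q) / 2) ((a p - a q) / 2) * Φ a) (a + u • vS p q) = 0 := by
      intro u
      refine Set.indicator_of_notMem (fun hu => ha ?_) _
      refine ⟨fun i hip hiq => ?_, ?_⟩
      · have := hu.1 i
        simpa [vS_o hip hiq] using this
      · have := hu.2
        rwa [sum_shift] at this
    simp only [key, integral_zero]

end fibre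

section pair
variable {m : ℕ}

lemma even_poly_int (c0 c2 c4 c6 c8 w : ℝ) :
    ∫ t in (-w)..w, (c0 + c2 * t ^ 2 + c4 * t ^ 4 + c6 * t ^ 6 + c8 * t ^ 8) =
      2 * (c0 * w + c2 * w ^ 3 / 3 + c4 * w ^ 5 / 5 + c6 * w ^ 7 / 7 + c8 * w ^ 9 / 9) := by
  have hd : ∀ t : ℝ, HasDerivAt
      (fun t => c0 * t + c2 * (t ^ 3 / 3) + c4 * (t ^ 5 / 5) + c6 * (t ^ 7 / 7) + c8 * (t ^ 9 / 9))
      (c0 + c2 * t ^ 2 + c4 * t ^ 4 + c6 * t ^ 6 + c8 * t ^ 8) t := by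
    intro t
    have := (((((hasDerivAt_id t).const_mul c0).add
      (((hasDerivAt_pow 3 t).div_const 3).const_mul c2)).add
      (((hasDerivAt_pow 5 t).div_const 5).const_mul c4)).add
      (((hasDerivAt_pow 7 t).div_const 7).const_mul c6)).add
      (((hasDerivAt_pow 9 t).div_const 9).const_mul c8)
    refine this.congr_deriv ?_
    norm_num
  rw [intervalIntegral.integral_eq_sub_of_hasDerivAt (fun x _ => hd x)
      (Continuous.intervalIntegrable (by fun_prop) _ _)]
  ring

noncomputable def wS (s : ℝ) : ℝ := Real.sqrt 3 - |s|

noncomputable def DS (s t : ℝ) : ℝ := t ^ 4 - 6 / 7 * wS s ^ 2 * t ^ 2 + 3 / 35 * wS s ^ 4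

noncomputable def dS (p q : Fin m) (a : Fin m → ℝ) : ℝ :=
  DS ((a p + a q) / 2) ((a p - a q) / 2)

lemma cont_dS (p q : Fin m) : Continuous (dS p q) := by
  unfold dS DS wS; fun_prop

lemma cont_psi : Continuous psiS := by unfold psiS; fun_prop

lemma pair1 {p q : Fin m} (h : p ≠ q) (Φ : (Fin m → ℝ) → ℝ)
    (hΦ : ∀ (a : Fin m → ℝ) (u : ℝ), Φ (a + u • vS p q) = Φ a) (hc : Continuous Φ) :
    ∫ a in OmS m, dS p q a * Φ a = 0 := by
  refine fibre1 h DS Φ hΦ ((cont_dS p q).mul hc) fun s _ => ?_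
  have e : ∀ t, DS s t = 3 / 35 * wS s ^ 4 + (-(6 / 7) * wS s ^ 2) * t ^ 2 + 1 * t ^ 4 + 0 * t ^ 6
      + 0 * t ^ 8 := fun t => by unfold DS; ring
  simp only [e]
  rw [even_poly_int]
  unfold wS; ring

lemma pair2 {p q : Fin m} (h : p ≠ q) :
    ∫ a in OmS m, (psiS (a p) + psiS (a q) - 2 * dS p q a) * dS p q a = 0 := by
  have hc := cont_dS p q
  have hc2 := cont_psi
  have hF : ∀ a : Fin m → ℝ, (psiS (a p) + psiS (a q) - 2 * dS p q a) * dS p q a =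
    (fun s t => (psiS (s + t) + psiS (s - t) - 2 * DS s t) * DS s t) ((a p + a q) / 2)
      ((a p - a q) / 2) * 1 := by
    intro a
    simp only [dS]
    rw [show (a p + a q) / 2 + (a p - a q) / 2 = a p by ring,
      show (a p + a q) / 2 - (a p - a q) / 2 = a q by ring]
    ring
  simp only [hF]
  refine fibre1 h (fun s t => (psiS (s + t) + psiS (s - t) - 2 * DS s t) * DS s t)
    (fun _ => 1) (fun _ _ => rfl) ?_ fun s _ => ?_
  · simp only [← hF]; fun_prop
  have e : ∀ t, (psiS (s + t) + psiS (s - t) - 2 * DS s t) * DS s t =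
      ((2 * s ^ 4 - 36 / 5 * s ^ 2 + 18 / 5 - 6 / 35 * wS s ^ 4) * (3 / 35 * wS s ^ 4))
      + ((12 * s ^ 2 - 36 / 5 + 12 / 7 * wS s ^ 2) * (3 / 35 * wS s ^ 4)
        - (2 * s ^ 4 - 36 / 5 * s ^ 2 + 18 / 5 - 6 / 35 * wS s ^ 4) * (6 / 7 * wS s ^ 2)) * t ^ 2
      + ((2 * s ^ 4 - 36 / 5 * s ^ 2 + 18 / 5 - 6 / 35 * wS s ^ 4)
        - (12 * s ^ 2 - 36 / 5 + 12 / 7 * wS s ^ 2) * (6 / 7 * wS s ^ 2)) * t ^ 4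
      + (12 * s ^ 2 - 36 / 5 + 12 / 7 * wS s ^ 2) * t ^ 6
      + 0 * t ^ 8 := fun t => by unfold DS psiS; ring
  simp only [e]
  rw [even_poly_int]
  unfold wS; ring

lemma pair3 {p q : Fin m} (h : p ≠ q) :
    ∫ a in OmS m, (dS p q a ^ 2 - 64 / 11025 * wS ((a p + a q) / 2) ^ 8) = 0 := by
  have hc := cont_dS p q
  have hF : ∀ a : Fin m → ℝ, dS p q a ^ 2 - 64 / 11025 * wS ((a p + a q) / 2) ^ 8 =
    (fun s t => DS s t ^ 2 - 64 / 11025 * wS s ^ 8) ((a p + a q) / 2)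
      ((a p - a q) / 2) * 1 := by
    intro a
    simp only [dS]
    ring
  simp only [hF]
  refine fibre1 h (fun s t => DS s t ^ 2 - 64 / 11025 * wS s ^ 8)
    (fun _ => 1) (fun _ _ => rfl) ?_ fun s _ => ?_
  · simp only [← hF]; unfold wS; fun_prop
  have e : ∀ t, DS s t ^ 2 - 64 / 11025 * wS s ^ 8 =
      (9 / 1225 * wS s ^ 8 - 64 / 11025 * wS s ^ 8)
      + (- (36 / 245) * wS s ^ 6) * t ^ 2
      + (36 / 49 * wS s ^ 4 + 6 / 35 * wS s ^ 4) * t ^ 4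
      + (- (12 / 7) * wS s ^ 2) * t ^ 6
      + 1 * t ^ 8 := fun t => by unfold DS; ring
  simp only [e]
  rw [even_poly_int]
  unfold wS; ring

/-- the full statistic on the first faces -/
noncomputable def PsiS (a : Fin m → ℝ) : ℝ := (∑ i, psiS (a i)) + psiS (0 - ∑ i, a i)

lemma cont_PsiS : Continuous (PsiS (m := m)) := by
  have := cont_psi
  unfold PsiS; fun_prop

lemma pair4 {p q : Fin m} (h : p ≠ q) :
    ∫ a in OmS m, dS p q a * PsiS a = 2 * ∫ a in OmS m, dS p q a ^ 2 := by
  have hc := cont_dS p q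
  have hc2 := cont_psi
  let Φ : (Fin m → ℝ) → ℝ := fun a =>
    (∑ i ∈ (Finset.univ.erase p).erase q, psiS (a i)) + psiS (0 - ∑ i, a i)
  have hΦc : Continuous Φ := by simp only [Φ]; fun_prop
  have h1 := pair1 h Φ (by
    intro a u
    simp only [Φ]
    rw [sum_shift]
    congr 1
    refine Finset.sum_congr rfl fun i hi => ?_
    simp only [Finset.mem_erase] at hi
    simp [vS_o hi.2.1 hi.1]) hΦc
  have h2 := pair2 h
  have e : ∀ a : Fin m → ℝ, dS p q a * PsiS a = dS p q a * Φ a +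
    (psiS (a p) + psiS (a q) - 2 * dS p q a) * dS p q a + 2 * dS p q a ^ 2 := by
    intro a
    have : ∑ i, psiS (a i) = (∑ i ∈ (Finset.univ.erase p).erase q, psiS (a i)) + psiS (a q)
        + psiS (a p) := by
      rw [Finset.sum_erase_add _ _ (by simp [h.symm]), Finset.sum_erase_add _ _ (by simp)]
    simp only [PsiS, Φ, this]; ring
  simp only [e]
  rw [integral_add, integral_add, h1, h2, integral_const_mul]
  · ring
  · exact cont_int (by fun_prop)
  · exact cont_int (by fun_prop)
  · exact cont_int (by fun_prop)
  · exact cont_int (by fun_prop)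

lemma pair5 {p q p' q' : Fin m} (h : p ≠ q) (h1 : p' ≠ p) (h2 : p' ≠ q) (h3 : q' ≠ p)
    (h4 : q' ≠ q) : ∫ a in OmS m, dS p q a * dS p' q' a = 0 := by
  refine pair1 h _ (fun a u => ?_) (cont_dS _ _)
  simp [dS, vS_o h1 h2, vS_o h3 h4]

lemma perm_int (e : Equiv.Perm (Fin m)) (f : (Fin m → ℝ) → ℝ) :
    ∫ a in OmS m, f (fun i => a (e i)) = ∫ a in OmS m, f a := by
  have hmp := volume_measurePreserving_piCongrLeft (fun _ : Fin m => ℝ) e.symm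
  have hfun : ∀ a : Fin m → ℝ, MeasurableEquiv.piCongrLeft (fun _ : Fin m => ℝ) e.symm a
      = fun i => a (e i) := by
    intro a
    funext i
    have := Equiv.piCongrLeft_apply (fun _ : Fin m => ℝ) e.symm a i
    simp at this
    exact this
  have := hmp.setIntegral_preimage_emb (MeasurableEquiv.measurableEmbedding _) f (OmS m)
  rw [← this]
  have hset : (MeasurableEquiv.piCongrLeft (fun _ : Fin m => ℝ) e.symm) ⁻¹' OmS m = OmS m := by
    ext a
    rw [Set.mem_preimage, hfun]
    simp only [OmS, Set.mem_ofPred_eq]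
    rw [Equiv.sum_comp e a]
    refine and_congr_left fun _ => ?_
    exact ⟨fun h i => by simpa using h (e.symm i), fun h i => h (e i)⟩
  rw [hset]
  simp only [hfun]

noncomputable def MS (p q : Fin m) : ℝ := ∫ a in OmS m, a p * a q

lemma MS_symm (p q : Fin m) : MS p q = MS q p := by
  unfold MS; simp only [mul_comm]

lemma MS_swap {p p' q : Fin m} (h : p ≠ q) (h' : p' ≠ q) : MS p q = MS p' q := by
  have := perm_int (Equiv.swap p p') (fun a : Fin m → ℝ => a p * a q)
  simp only [Equiv.swap_apply_left, Equiv.swap_apply_of_ne_of_ne h.symm h'.symm] at this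
  exact this.symm

lemma MS_all {p q p' q' : Fin m} (h : p ≠ q) (h' : p' ≠ q') : MS p q = MS p' q' := by
  by_cases h1 : p' = q
  · subst h1
    rw [MS_symm p' q']; exact MS_swap h h'.symm
  · rw [MS_swap h h1, MS_symm, MS_swap (Ne.symm h1) h'.symm, MS_symm]

noncomputable def VS (m : ℕ) : ℝ := (volume : Measure (Fin m → ℝ)).real (OmS m)

lemma int_const_Om (c : ℝ) : ∫ _a in OmS m, c = VS m * c := by
  simp [VS, Measure.real]

lemma VS_nonneg : 0 ≤ VS m := measureReal_nonneg

lemma MS_le {p q : Fin m} (h : p ≠ q) : (m : ℝ) * ((m : ℝ) - 1) * MS p q ≤ 3 * VS m := by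
  have e : ∫ a in OmS m, (∑ i, a i) ^ 2 = ∑ i : Fin m, ∑ j : Fin m, MS i j := by
    unfold MS
    simp only [sq, Finset.sum_mul_sum]
    rw [integral_finsetSum _ fun i _ => cont_int (by fun_prop)]
    refine Finset.sum_congr rfl fun i _ => ?_
    rw [integral_finsetSum _ fun i _ => cont_int (by fun_prop)]
  have h1 : ∫ a in OmS m, (∑ i, a i) ^ 2 ≤ VS m * 3 := by
    rw [← int_const_Om]
    refine setIntegral_mono_on (cont_int (by fun_prop)) (cont_int (by fun_prop)) OmS_meas ?_
    intro a ha
    have := ha.2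
    rw [← sq3]
    exact sq_le_sq' (by linarith [this.2]) (by linarith [this.1])
  have h2 : ∀ i : Fin m, ((m : ℝ) - 1) * MS p q ≤ ∑ j, MS i j := by
    intro i
    rw [← Finset.add_sum_erase _ _ (Finset.mem_univ i)]
    have h0 : 0 ≤ MS i i := integral_nonneg fun a => mul_self_nonneg _
    have : ∑ j ∈ Finset.univ.erase i, MS i j = ∑ j ∈ Finset.univ.erase i, MS p q :=
      Finset.sum_congr rfl fun j hj => MS_all (by simpa [eq_comm] using hj) h
    rw [this, Finset.sum_const, Finset.card_erase_of_mem (Finset.mem_univ i), nsmul_eq_mul,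
      Finset.card_univ, Fintype.card_fin, Nat.cast_sub (by have := i.2; omega)]
    push_cast
    linarith
  have h3 : ∑ _i : Fin m, ((m : ℝ) - 1) * MS p q ≤ ∑ i, ∑ j, MS i j :=
    Finset.sum_le_sum fun i _ => h2 i
  simp at h3
  linarith

lemma wS_lower (s : ℝ) : (1 / 5) ^ 8 / 9 * (9 - (2 * s) ^ 2) ≤ wS s ^ 8 := by
  by_cases h : 3 ≤ |2 * s|
  · have : 9 ≤ (2 * s) ^ 2 := by rw [← sq_abs]; nlinarith
    have h8 : 0 ≤ wS s ^ 8 := by positivity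
    nlinarith
  · push Not at h
    have hs : |s| < 3 / 2 := by rw [abs_mul] at h; norm_num at h; linarith
    have h17 : 17 / 10 ≤ Real.sqrt 3 := Real.le_sqrt_of_sq_le (by norm_num)
    have hw : 1 / 5 ≤ wS s := by unfold wS; linarith
    have := pow_le_pow_left₀ (by norm_num) hw 8
    nlinarith [sq_nonneg (2 * s)]

lemma dS_sq_lower (hm : 3 ≤ m) {p q : Fin m} (h : p ≠ q) :
    64 / 11025 * ((1 / 5) ^ 8 / 9 * 2) * VS m ≤ ∫ a in OmS m, dS p q a ^ 2 := by
  have hc := cont_dS p q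
  have h3 := pair3 h
  have hwc : Continuous (fun a : Fin m → ℝ => wS ((a p + a q) / 2) ^ 8) := by unfold wS; fun_prop
  rw [integral_sub (cont_int (by fun_prop)) (cont_int (by fun_prop)), integral_const_mul] at h3
  have h4 : ∫ a in OmS m, (1 / 5) ^ 8 / 9 * (3 - 2 * (a p * a q)) ≤
      ∫ a in OmS m, wS ((a p + a q) / 2) ^ 8 := by
    refine setIntegral_mono_on (cont_int (by fun_prop)) (cont_int hwc) OmS_meas ?_
    intro a ha
    refine le_trans ?_ (wS_lower _)
    have b : ∀ i, a i ^ 2 ≤ 3 := fun i => by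
      rw [← sq3]; exact sq_le_sq' (ha.1 i).1 (ha.1 i).2
    have := b p
    have := b q
    have : (2 * ((a p + a q) / 2)) ^ 2 = a p ^ 2 + a q ^ 2 + 2 * (a p * a q) := by ring
    rw [this]
    linarith
  rw [integral_const_mul, integral_sub (cont_int (by fun_prop)) (cont_int (by fun_prop)),
    integral_const_mul, int_const_Om] at h4
  have h5 := MS_le h
  have e5 : ∫ a in OmS m, a p * a q = MS p q := rfl
  rw [e5] at h4
  have hm' : (3:ℝ) ≤ m := by exact_mod_cast hm
  have h6 : 2 * MS p q ≤ VS m := by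
    by_cases hM : MS p q ≤ 0
    · linarith [VS_nonneg (m := m)]
    · push Not at hM
      have : (6:ℝ) ≤ m * (m - 1) := by nlinarith
      nlinarith
  have hV := VS_nonneg (m := m)
  nlinarith

lemma VS_pos : 0 < VS m := by
  have hfin : volume (OmS m) ≠ ⊤ := OmS_compact.measure_lt_top.ne
  have ho : IsOpen {a : Fin m → ℝ | (∀ i, a i ∈ Set.Ioo (-Real.sqrt 3) (Real.sqrt 3)) ∧
    (0 - ∑ i, a i) ∈ Set.Ioo (-Real.sqrt 3) (Real.sqrt 3)} := by
    refine IsOpen.and ?_ ?_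
    · have : {a : Fin m → ℝ | ∀ i, a i ∈ Set.Ioo (-Real.sqrt 3) (Real.sqrt 3)} =
        ⋂ i, (fun a : Fin m → ℝ => a i) ⁻¹' Set.Ioo (-Real.sqrt 3) (Real.sqrt 3) := by
        ext a; simp only [Set.mem_iInter, Set.mem_preimage]; rfl
      rw [this]
      exact isOpen_iInter_of_finite fun i => isOpen_Ioo.preimage (by fun_prop)
    · exact isOpen_Ioo.preimage (f := fun a : Fin m → ℝ => 0 - ∑ i, a i) (by fun_prop)
  have hpos := ho.measure_pos volume ⟨0, by
    have := s3pos
    refine ⟨fun i => ?_, ?_⟩ <;> simp [this]⟩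
  refine ENNReal.toReal_pos (hpos.trans_le (measure_mono ?_)).ne' hfin
  intro a ha
  exact ⟨fun i => Set.Ioo_subset_Icc_self (ha.1 i), Set.Ioo_subset_Icc_self ha.2⟩

end pair

section final
variable {m : ℕ}

lemma ext_castSucc (a : Fin m → ℝ) (i : Fin m) : extendDie (m + 1) 0 a i.castSucc = a i := by
  simp [extendDie]

lemma ext_last (a : Fin m → ℝ) : extendDie (m + 1) 0 a (Fin.last m) = 0 - ∑ i, a i := by
  simp [extendDie]

noncomputable def PS (m : ℕ) : Measure (Fin m → ℝ) := ProbabilityTheory.cond volume (OmS m)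

lemma vol_ne_zero : volume (OmS m) ≠ 0 := fun h => by
  have := VS_pos (m := m)
  simp [VS, Measure.real, h] at this

instance : IsProbabilityMeasure (PS m) :=
  ProbabilityTheory.cond_isProbabilityMeasure_of_finite vol_ne_zero OmS_compact.measure_lt_top.ne

lemma int_PS (f : (Fin m → ℝ) → ℝ) : ∫ a, f a ∂(PS m) = (VS m)⁻¹ * ∫ a in OmS m, f a := by
  unfold PS ProbabilityTheory.cond
  rw [integral_smul_measure, ENNReal.toReal_inv, smul_eq_mul]; rfl

lemma integrable_PS {f : (Fin m → ℝ) → ℝ} (hf : Continuous f) : Integrable f (PS m) := by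
  unfold PS ProbabilityTheory.cond
  exact (cont_int hf).smul_measure (ENNReal.inv_ne_top.2 vol_ne_zero)

lemma dice_eq : diceMeasure (m + 1) (-Real.sqrt 3) (Real.sqrt 3) 0 =
    Measure.map (extendDie (m + 1) 0) (PS m) := rfl

lemma cont_ext : Continuous (extendDie (m + 1) 0 : (Fin m → ℝ) → Fin (m + 1) → ℝ) := by
  refine continuous_pi fun i => ?_
  refine Fin.lastCases ?_ (fun i => ?_) i
  · have : (fun a : Fin m → ℝ => extendDie (m + 1) 0 a (Fin.last m)) = fun a => 0 - ∑ i, a i :=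
      funext ext_last
    exact this ▸ (by fun_prop)
  · have : (fun a : Fin m → ℝ => extendDie (m + 1) 0 a i.castSucc) = fun a => a i :=
      funext fun a => ext_castSucc a i
    exact this ▸ (by fun_prop)

def pJ (j : Fin (m / 2)) : Fin m := ⟨2 * j, by have := j.2; omega⟩
def qJ (j : Fin (m / 2)) : Fin m := ⟨2 * j + 1, by have := j.2; omega⟩

lemma pq_ne (j : Fin (m / 2)) : pJ j ≠ qJ j := by simp [pJ, qJ]

noncomputable def DT (a : Fin m → ℝ) : ℝ := ∑ j : Fin (m / 2), dS (pJ j) (qJ j) a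

noncomputable def DD (A : Fin (m + 1) → ℝ) : ℝ := DT (fun i : Fin m => A i.castSucc)

lemma cont_DT : Continuous (DT (m := m)) := by
  have := fun j : Fin (m / 2) => cont_dS (pJ j) (qJ j)
  unfold DT; fun_prop

lemma cont_DD : Continuous (DD (m := m)) := by
  have := cont_DT (m := m)
  unfold DD; fun_prop

lemma DD_ext (a : Fin m → ℝ) : DD (extendDie (m + 1) 0 a) = DT a := by
  simp only [DD, ext_castSucc]

lemma DT_sq : ∫ a in OmS m, DT a ^ 2 = ∑ j, ∫ a in OmS m, dS (pJ j) (qJ j) a ^ 2 := by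
  have hc := fun j : Fin (m / 2) => cont_dS (pJ j) (qJ j)
  simp only [DT, sq, Finset.sum_mul_sum]
  rw [integral_finsetSum _ fun i _ => cont_int (by fun_prop)]
  refine Finset.sum_congr rfl fun i _ => ?_
  rw [integral_finsetSum _ fun i _ => cont_int (by fun_prop), Finset.sum_eq_single i]
  · intro j _ hj
    have hj' : (j : ℕ) ≠ i := fun h => hj (Fin.ext h)
    refine pair5 (pq_ne i) ?_ ?_ ?_ ?_ <;> simp only [pJ, qJ, ne_eq, Fin.mk.injEq] <;> omega
  · simp

lemma DT_Psi : ∫ a in OmS m, DT a * PsiS a = 2 * ∫ a in OmS m, DT a ^ 2 := by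
  have hc := fun j : Fin (m / 2) => cont_dS (pJ j) (qJ j)
  have hP := cont_PsiS (m := m)
  rw [DT_sq]
  simp only [DT, Finset.sum_mul]
  rw [integral_finsetSum _ fun i _ => cont_int (by fun_prop), Finset.mul_sum]
  exact Finset.sum_congr rfl fun i _ => pair4 (pq_ne i)

lemma final (hm : 3 ≤ m) :
    (175 / 5184) ^ 2 * (64 / 11025 * ((1 / 5) ^ 8 / 9 * 2) / 4) ^ 2 * ((m + 1 : ℕ) : ℝ) ^ 2 ≤
    ∫ p, FS (m + 1) p ^ 2
          ∂((diceMeasure (m + 1) (-Real.sqrt 3) (Real.sqrt 3) 0).prod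
              (diceMeasure (m + 1) (-Real.sqrt 3) (Real.sqrt 3) 0)) := by
  rw [dice_eq]
  have hem : AEMeasurable (extendDie (m + 1) 0) (PS m) := cont_ext.measurable.aemeasurable
  have : IsProbabilityMeasure (Measure.map (extendDie (m + 1) 0) (PS m)) :=
    Measure.isProbabilityMeasure_map hem
  have i1 : Integrable DD (Measure.map (extendDie (m + 1) 0) (PS m)) :=
    (integrable_map_measure cont_DD.aestronglyMeasurable hem).2
      (integrable_PS (cont_DD.comp cont_ext))
  have i2 : Integrable (fun A => DD A ^ 2) (Measure.map (extendDie (m + 1) 0) (PS m)) :=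
    (integrable_map_measure (cont_DD.pow 2).aestronglyMeasurable hem).2
      (integrable_PS ((cont_DD.pow 2).comp cont_ext))
  have key := partI (Measure.map (extendDie (m + 1) 0) (PS m)) cont_DD.measurable i1 i2
    (175 / 5184) (by norm_num)
  refine le_trans ?_ key
  set κ := (VS m)⁻¹ * ∫ a in OmS m, DT a ^ 2 with hκ
  have e2 : ∫ A, DD A ^ 2 ∂(Measure.map (extendDie (m + 1) 0) (PS m)) = κ := by
    have hp : Continuous (fun A : Fin (m + 1) → ℝ => DD A ^ 2) := cont_DD.pow 2
    rw [integral_map hem hp.aestronglyMeasurable]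
    refine (int_PS (m := m) (fun a => DD (extendDie (m + 1) 0 a) ^ 2)).trans ?_
    simp only [DD_ext]; rfl
  have e1 : ∫ A, DD A * meanS (fun x => gDie (m + 1) A x * phiS x)
      ∂(Measure.map (extendDie (m + 1) 0) (PS m)) = -(8 * Real.sqrt 3)⁻¹ * (2 * κ) := by
    have hmeas : Measurable (fun A : Fin (m + 1) → ℝ =>
        meanS (fun x => gDie (m + 1) A x * phiS x)) :=
      meas_meanS (f := fun A x => gDie (m + 1) A x * phiS x)
        ((meas_gDie (m + 1)).mul (cont_phiS.measurable.comp measurable_snd))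
    have hm2 : Measurable (fun A : Fin (m + 1) → ℝ =>
        DD A * meanS (fun x => gDie (m + 1) A x * phiS x)) := cont_DD.measurable.mul hmeas
    rw [integral_map hem hm2.aestronglyMeasurable]
    refine (int_PS (m := m) (fun a => DD (extendDie (m + 1) 0 a) *
        meanS (fun x => gDie (m + 1) (extendDie (m + 1) 0 a) x * phiS x))).trans ?_
    have : ∀ a ∈ OmS m, DD (extendDie (m + 1) 0 a) *
        meanS (fun x => gDie (m + 1) (extendDie (m + 1) 0 a) x * phiS x) =
        -(8 * Real.sqrt 3)⁻¹ * (DT a * PsiS a) := by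
      intro a ha
      rw [DD_ext, Q_eq, Fin.sum_univ_castSucc]
      · simp only [ext_castSucc, ext_last, PsiS]; ring
      · intro i
        refine Fin.lastCases ?_ (fun i => ?_) i
        · rw [ext_last]; exact ha.2
        · rw [ext_castSucc]; exact ha.1 i
    rw [setIntegral_congr_fun OmS_meas this, integral_const_mul, DT_Psi, hκ]
    ring
  have hκl : 64 / 11025 * ((1 / 5) ^ 8 / 9 * 2) / 4 * ((m + 1 : ℕ) : ℝ) ≤ κ := by
    have hV := VS_pos (m := m)
    rw [hκ, DT_sq, le_inv_mul_iff₀ hV]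
    have h1 : ∑ _j : Fin (m / 2), 64 / 11025 * ((1 / 5) ^ 8 / 9 * 2) * VS m ≤
        ∑ j : Fin (m / 2), ∫ a in OmS m, dS (pJ j) (qJ j) a ^ 2 :=
      Finset.sum_le_sum fun j _ => dS_sq_lower hm (pq_ne j)
    refine le_trans ?_ h1
    rw [Finset.sum_const, Finset.card_univ, Fintype.card_fin, nsmul_eq_mul]
    have h2 : ((m + 1 : ℕ) : ℝ) ≤ 4 * ((m / 2 : ℕ) : ℝ) := by
      exact_mod_cast (by omega : m + 1 ≤ 4 * (m / 2))
    have := mul_le_mul_of_nonneg_right h2 hV.le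
    nlinarith
  have h0 : 0 ≤ 64 / 11025 * ((1 / 5) ^ 8 / 9 * 2) / 4 * ((m + 1 : ℕ) : ℝ) := by positivity
  have hsq := pow_le_pow_left₀ h0 hκl 2
  rw [e1, e2]
  have e3 : (-(8 * Real.sqrt 3)⁻¹ * (2 * κ)) ^ 2 = κ ^ 2 / 48 := by
    have e4 : (-(8 * Real.sqrt 3)⁻¹ * (2 * κ)) ^ 2 = (Real.sqrt 3 ^ 2)⁻¹ * κ ^ 2 / 16 := by
      rw [mul_inv]; ring
    rw [e4, sq3]; ring
  rw [e3]
  nlinarith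

end final

theorem cond_covariance_second_moment :
    ∃ c > (0 : ℝ), ∃ N : ℕ, ∀ n : ℕ, N ≤ n →
      c * (n : ℝ) ^ 2 ≤
        ∫ p, (cvDie₂ n p.1 p.2 - cvDie n p.1 * cvDie n p.2) ^ 2
          ∂((diceMeasure n (-Real.sqrt 3) (Real.sqrt 3) 0).prod
              (diceMeasure n (-Real.sqrt 3) (Real.sqrt 3) 0)) := by
  refine ⟨(175 / 5184) ^ 2 * (64 / 11025 * ((1 / 5) ^ 8 / 9 * 2) / 4) ^ 2, by norm_num, 4, ?_⟩
  intro n hn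
  obtain ⟨m, rfl⟩ : ∃ m, n = m + 1 := ⟨n - 1, by omega⟩
  exact final (by omega)
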